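/- arXiv:2411.04169 — 2 statements merged into one kernel-verified Lean document; each statement's English description precedes it below -/
import Mathlib

section
/- Let n ≥ 2 be even and d ≥ 1. Let A denote the spoofing algorithm of Gao et al. with the greedy partition strategy. Then E_{U∼𝒟_{n,d}}[XEB(U,A)] ≥ (1 + (1/15)^d)^{n/(d²+1)}. -/
open MeasureTheory
open scoped BigOperators Classical

noncomputable section

/-! ## The all-to-all random quantum circuit ensemble and the spoofing algorithm of Gao et al.

An `n`-qubit state vector is indexed by bitstrings `Fin n → Fin 2`; operators are matrices
over this index type.  A depth-`d` all-to-all circuit is described by, for each layer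
`i : Fin d`, a permutation of the qubits and `n/2` two-qubit gates, the `l`-th gate of layer
`i` acting on qubits `σ_i(2l)` and `σ_i(2l+1)`. -/

/-- A two-qubit gate: an element of `U(4)`, acting on `ℂ²⊗ℂ²`. -/
abbrev Gate : Type := Matrix.unitaryGroup (Fin 2 × Fin 2) ℂ

instance : MeasurableSpace Gate := borel _
instance : BorelSpace Gate := ⟨rfl⟩

instance {α : Type*} : MeasurableSpace (Equiv.Perm α) := ⊤

/-- The data of an `n`-qubit depth-`d` all-to-all circuit: for each layer a permutation of
the qubits and a tuple of `n/2` two-qubit gates. -/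
abbrev Ens (n d : ℕ) : Type :=
  (Fin d → Equiv.Perm (Fin n)) × (Fin d → Fin (n / 2) → Gate)

/-- First qubit `σ_i(2l)` acted on by gate `l` of layer `i`. -/
def qA {n d : ℕ} (C : Ens n d) (i : Fin d) (l : Fin (n / 2)) : Fin n :=
  C.1 i ⟨2 * l.1, by have := l.2; omega⟩

/-- Second qubit `σ_i(2l+1)` acted on by gate `l` of layer `i`. -/
def qB {n d : ℕ} (C : Ens n d) (i : Fin d) (l : Fin (n / 2)) : Fin n :=
  C.1 i ⟨2 * l.1 + 1, by have := l.2; omega⟩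

/-- The `n`-qubit operator obtained by applying the two-qubit gate `g` to qubits `a` and `b`
and the identity to all other qubits. -/
def applyGate {n : ℕ} (a b : Fin n) (g : Matrix (Fin 2 × Fin 2) (Fin 2 × Fin 2) ℂ) :
    Matrix (Fin n → Fin 2) (Fin n → Fin 2) ℂ :=
  Matrix.of fun x y =>
    (if ∀ i : Fin n, i ≠ a → i ≠ b → x i = y i then (1 : ℂ) else 0) * g (x a, x b) (y a, y b)

/-- The unitary of one layer of a circuit, with the gates of the layer optionally modified by
`f` (the layer's gates act on pairwise disjoint qubits, so they commute and the product
order is immaterial). -/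
def layerU {n d : ℕ} (C : Ens n d) (f : Fin d → Fin (n / 2) → Matrix (Fin 2 × Fin 2) (Fin 2 × Fin 2) ℂ)
    (i : Fin d) : Matrix (Fin n → Fin 2) (Fin n → Fin 2) ℂ :=
  ((List.finRange (n / 2)).map fun l => applyGate (qA C i l) (qB C i l) (f i l)).prod

/-- The full circuit unitary, given the (possibly modified) gates `f`. -/
def circU {n d : ℕ} (C : Ens n d)
    (f : Fin d → Fin (n / 2) → Matrix (Fin 2 × Fin 2) (Fin 2 × Fin 2) ℂ) :
    Matrix (Fin n → Fin 2) (Fin n → Fin 2) ℂ :=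
  ((List.finRange d).map fun i => layerU C f i).prod

/-- The output distribution `q_U(x) = |⟨x|U|0^n⟩|²` of the (unmodified) circuit. -/
def outDist {n d : ℕ} (C : Ens n d) (x : Fin n → Fin 2) : ℝ :=
  Complex.normSq (circU C (fun i l => (C.2 i l : Matrix (Fin 2 × Fin 2) (Fin 2 × Fin 2) ℂ))
    x fun _ => 0)

/-- The interaction graph adjacency: `j ∼ k` iff `j ≠ k` and some gate of the circuit acts
on qubits `j` and `k`. -/
def interactionAdj {n d : ℕ} (C : Ens n d) (j k : Fin n) : Prop :=
  j ≠ k ∧ ∃ i : Fin d, ∃ l : Fin (n / 2),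
    (qA C i l = j ∧ qB C i l = k) ∨ (qA C i l = k ∧ qB C i l = j)

/-- The greedy partition loop: while `G ≠ ∅`, pick the smallest `i ∈ G`, let `P_i` be the
closed neighborhood of `i` in the interaction graph, add `P_i` to the collection, and delete
from `G` every qubit adjacent to some qubit of `P_i`.  (`fuel` guarantees termination; since
in a depth-`d ≥ 1` circuit every qubit is touched by a gate, `fuel = n` reproduces the
algorithm.) -/
def greedyAux (n : ℕ) (adj : Fin n → Fin n → Prop) :
    ℕ → Finset (Fin n) → Finset (Finset (Fin n))
  | 0, _ => ∅
  | fuel + 1, G =>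
    if h : G.Nonempty then
      let i := G.min' h
      let P : Finset (Fin n) := insert i (Finset.univ.filter fun j => adj i j)
      let D : Finset (Fin n) := Finset.univ.filter fun j => ∃ k ∈ P, adj j k
      insert P (greedyAux n adj fuel (G \ D))
    else ∅

/-- The greedy partition `P̂`: the blocks produced by the greedy loop, together with a
singleton block for every qubit not covered by them. -/
def greedyPartition (n : ℕ) (adj : Fin n → Fin n → Prop) : Finset (Finset (Fin n)) :=
  greedyAux n adj n Finset.univ ∪
    ((Finset.univ \ (greedyAux n adj n Finset.univ).sup id).image fun j => {j})

/-- Two qubits lie in a common block of the greedy partition. -/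
def sameBlock (n : ℕ) (adj : Fin n → Fin n → Prop) (j k : Fin n) : Prop :=
  ∃ B ∈ greedyPartition n adj, j ∈ B ∧ k ∈ B

/-- The distribution sampled by the spoofing algorithm of Gao et al.: every gate joining two
different blocks of the greedy partition is replaced by the identity, yielding a disjoint
product circuit `Ũ = Ũ_1 ⊗ ⋯ ⊗ Ũ_K`, and each block is sampled from its own output
distribution; equivalently `A_U(x) = |⟨x|Ũ|0^n⟩|²`. -/
def spoofDist {n d : ℕ} (C : Ens n d) (x : Fin n → Fin 2) : ℝ :=
  Complex.normSq (circU C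
    (fun i l =>
      if sameBlock n (interactionAdj C) (qA C i l) (qB C i l) then
        (C.2 i l : Matrix (Fin 2 × Fin 2) (Fin 2 × Fin 2) ℂ)
      else 1)
    x fun _ => 0)

/-- The linear cross-entropy score `XEB(U,A) = 2^n ∑_x A_U(x) q_U(x)` of the spoofing
algorithm on the circuit `C`. -/
def xebSpoof (n d : ℕ) (C : Ens n d) : ℝ :=
  2 ^ n * ∑ x : Fin n → Fin 2, spoofDist C x * outDist C x

/-- The distribution `𝒟_{n,d}` of `n`-qubit depth-`d` all-to-all random circuits: each
layer's permutation is uniformly random and each gate is an independent Haar-random element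
of `U(4)` (specified by a Haar probability measure `μG` on `U(4)`). -/
def ensMeasure (n d : ℕ) (μG : Measure Gate) : Measure (Ens n d) :=
  (Measure.pi fun _ : Fin d => (PMF.uniformOfFintype (Equiv.Perm (Fin n))).toMeasure).prod
    (Measure.pi fun _ : Fin d => Measure.pi fun _ : Fin (n / 2) => μG)

open scoped Kronecker Matrix

/-! ### Pauli operators -/

/-- The single-qubit Pauli matrices `1, X, Y, Z`. -/
def pauli : Fin 4 → Matrix (Fin 2) (Fin 2) ℂ :=
  ![1, !![0, 1; 1, 0], !![0, -Complex.I; Complex.I, 0], !![1, 0; 0, -1]]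

/-- The two-qubit Pauli matrices. -/
def pauliPair (q : Fin 4 × Fin 4) : Matrix (Fin 2 × Fin 2) (Fin 2 × Fin 2) ℂ :=
  pauli q.1 ⊗ₖ pauli q.2

/-- The Pauli labels `p` and `q` anticommute. -/
def pauliAnti (p q : Fin 4) : Bool := p ≠ 0 && q ≠ 0 && p ≠ q

lemma pauli_mul_self (p : Fin 4) : pauli p * pauli p = 1 := by
  fin_cases p <;> ext i j <;> fin_cases i <;> fin_cases j <;>
    simp [pauli, Matrix.mul_apply]

lemma pauli_conjTranspose (p : Fin 4) : (pauli p)ᴴ = pauli p := by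
  fin_cases p <;> ext i j <;> fin_cases i <;> fin_cases j <;>
    simp [pauli]

lemma pauli_mul_comm (p q : Fin 4) :
    pauli p * pauli q = (if pauliAnti p q then (-1 : ℂ) else 1) • (pauli q * pauli p) := by
  fin_cases p <;> fin_cases q <;> ext i j <;> fin_cases i <;> fin_cases j <;>
    simp [pauli, Matrix.mul_apply, pauliAnti]

lemma sum_pauli_mul_pauli (s t s' t' : Fin 2) :
    ∑ q, pauli q s t * pauli q s' t' = if s = t' ∧ t = s' then 2 else 0 := by
  fin_cases s <;> fin_cases t <;> fin_cases s' <;> fin_cases t' <;>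
    norm_num [pauli, Fin.sum_univ_succ]

lemma pauliPair_mul_self (q : Fin 4 × Fin 4) : pauliPair q * pauliPair q = 1 := by
  simp [pauliPair, ← Matrix.mul_kronecker_mul, pauli_mul_self]

lemma pauliPair_conjTranspose (q : Fin 4 × Fin 4) : (pauliPair q)ᴴ = pauliPair q := by
  simp [pauliPair, Matrix.conjTranspose_kronecker, pauli_conjTranspose]

lemma pauliPair_anticomm {p q : Fin 4 × Fin 4}
    (h : (pauliAnti p.1 q.1 ^^ pauliAnti p.2 q.2) = true) :
    pauliPair p * pauliPair q = -(pauliPair q * pauliPair p) := by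
  rw [pauliPair, pauliPair, ← Matrix.mul_kronecker_mul, ← Matrix.mul_kronecker_mul,
    pauli_mul_comm p.1, pauli_mul_comm p.2]
  cases h1 : pauliAnti p.1 q.1 <;> cases h2 : pauliAnti p.2 q.2 <;> simp [h1, h2] at h ⊢
  · rw [← neg_one_smul ℂ (pauli q.2 * pauli p.2), Matrix.kronecker_smul, neg_one_smul]
  · rw [← neg_one_smul ℂ (pauli q.1 * pauli p.1), Matrix.smul_kronecker, neg_one_smul]

lemma exists_pauliAnti (p q : Fin 4 × Fin 4) (hp : p ≠ 0) (hq : q ≠ 0) :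
    ∃ r : Fin 4 × Fin 4, (pauliAnti p.1 r.1 ^^ pauliAnti p.2 r.2) = true ∧
      (pauliAnti r.1 q.1 ^^ pauliAnti r.2 q.2) = true := by
  revert p q
  decide

lemma sum_pauliPair_mul_pauliPair (s t s' t' : Fin 2 × Fin 2) :
    ∑ q, pauliPair q s t * pauliPair q s' t' = if s = t' ∧ t = s' then 4 else 0 := by
  have h : ∑ q, pauliPair q s t * pauliPair q s' t' =
      (∑ q, pauli q s.1 t.1 * pauli q s'.1 t'.1) * ∑ q, pauli q s.2 t.2 * pauli q s'.2 t'.2 := by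
    rw [Fintype.sum_prod_type, Finset.sum_mul_sum]
    refine Finset.sum_congr rfl fun a _ => Finset.sum_congr rfl fun b _ => ?_
    simp only [pauliPair, Matrix.kroneckerMap_apply]
    ring
  rw [h, sum_pauli_mul_pauli, sum_pauli_mul_pauli]
  obtain ⟨s1, s2⟩ := s
  obtain ⟨t1, t2⟩ := t
  obtain ⟨u1, u2⟩ := s'
  obtain ⟨w1, w2⟩ := t'
  simp only [Prod.mk.injEq]
  split_ifs <;> first | (exfalso; tauto) | norm_num

/-- A Pauli matrix as a gate. -/
def pauliGate (q : Fin 4 × Fin 4) : Gate :=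
  ⟨pauliPair q, by
    rw [Matrix.mem_unitaryGroup_iff, Matrix.star_eq_conjTranspose, pauliPair_conjTranspose,
      pauliPair_mul_self]⟩

/-- Anticommuting Pauli matrices are conjugate under a gate. -/
lemma exists_gate_conj_of_anti {p q : Fin 4 × Fin 4}
    (h : (pauliAnti p.1 q.1 ^^ pauliAnti p.2 q.2) = true) :
    ∃ g : Gate, (g : Matrix _ _ ℂ)ᴴ * pauliPair p * (g : Matrix _ _ ℂ) = pauliPair q := by
  have hpq := pauliPair_anticomm h
  have hp := pauliPair_mul_self p
  have hq := pauliPair_mul_self q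
  set P := pauliPair p with hP
  set Q := pauliPair q with hQ
  set c : ℂ := (((Real.sqrt 2)⁻¹ : ℝ) : ℂ) with hc
  have hcc : c * c = 1 / 2 := by
    rw [hc, ← Complex.ofReal_mul, ← mul_inv, Real.mul_self_sqrt (by norm_num)]
    norm_num
  have hstar : (c • (P + Q))ᴴ = c • (P + Q) := by
    rw [Matrix.conjTranspose_smul, Matrix.conjTranspose_add, hP, hQ, pauliPair_conjTranspose,
      pauliPair_conjTranspose, hc]
    simp
  have hsq : c • (P + Q) * (c • (P + Q)) = 1 := by
    rw [smul_mul_smul_comm, hcc, mul_add, add_mul, add_mul, hp, hq, hpq]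
    have : (1 : Matrix (Fin 2 × Fin 2) (Fin 2 × Fin 2) ℂ) + Q * P + (-(Q * P) + 1) =
      (2 : ℂ) • 1 := by rw [two_smul]; abel
    rw [this, smul_smul]
    norm_num
  refine ⟨⟨c • (P + Q), ?_⟩, ?_⟩
  · rw [Matrix.mem_unitaryGroup_iff, Matrix.star_eq_conjTranspose, hstar, hsq]
  · change (c • (P + Q))ᴴ * P * (c • (P + Q)) = Q
    rw [hstar, smul_mul_assoc, smul_mul_smul_comm, hcc]
    have h1 : (P + Q) * P * (P + Q) = (2 : ℂ) • Q := by
      have e1 : P * P * Q = Q := by rw [hp, one_mul]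
      have e2 : Q * P * P = Q := by rw [mul_assoc, hp, mul_one]
      have e3 : Q * P * Q = -P := by rw [mul_assoc, hpq, mul_neg, ← mul_assoc, hq, one_mul]
      have e4 : P * P * P = P := by rw [hp, one_mul]
      rw [add_mul, add_mul, mul_add, mul_add, e1, e2, e3, e4, two_smul]
      abel
    rw [h1, smul_smul]
    norm_num

/-- All nontrivial two-qubit Pauli matrices are conjugate under gates. -/
lemma exists_gate_conj (p q : Fin 4 × Fin 4) (hp : p ≠ 0) (hq : q ≠ 0) :
    ∃ g : Gate, (g : Matrix _ _ ℂ)ᴴ * pauliPair p * (g : Matrix _ _ ℂ) = pauliPair q := by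
  obtain ⟨r, h1, h2⟩ := exists_pauliAnti p q hp hq
  obtain ⟨g, hg⟩ := exists_gate_conj_of_anti h1
  obtain ⟨g', hg'⟩ := exists_gate_conj_of_anti h2
  refine ⟨g * g', ?_⟩
  rw [← hg', ← hg]
  simp [Matrix.conjTranspose_mul, mul_assoc]

/-- Every nontrivial two-qubit Pauli matrix is conjugate to its negative. -/
lemma exists_gate_conj_neg (p : Fin 4 × Fin 4) (hp : p ≠ 0) :
    ∃ g : Gate, (g : Matrix _ _ ℂ)ᴴ * pauliPair p * (g : Matrix _ _ ℂ) = -pauliPair p := by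
  obtain ⟨r, h1, -⟩ := exists_pauliAnti p p hp hp
  refine ⟨pauliGate r, ?_⟩
  change (pauliPair r)ᴴ * pauliPair p * pauliPair r = _
  rw [pauliPair_conjTranspose, mul_assoc, pauliPair_anticomm h1, mul_neg, ← mul_assoc,
    pauliPair_mul_self, one_mul]

lemma sum_trace_mul_pauliPair (A B : Matrix (Fin 2 × Fin 2) (Fin 2 × Fin 2) ℂ) :
    ∑ q, (A * pauliPair q).trace * (B * pauliPair q).trace = 4 * (A * B).trace := by
  have expand : ∀ q, (A * pauliPair q).trace * (B * pauliPair q).trace =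
      ∑ t, ∑ s, ∑ t', ∑ s', A t s * B t' s' * (pauliPair q s t * pauliPair q s' t') := by
    intro q
    rw [mul_comm]
    simp only [Matrix.trace, Matrix.diag, Matrix.mul_apply, Finset.sum_mul, Finset.mul_sum]
    refine Finset.sum_congr rfl fun t _ => Finset.sum_congr rfl fun s _ =>
      Finset.sum_congr rfl fun t' _ => Finset.sum_congr rfl fun s' _ => ?_
    ring
  simp only [expand]
  rw [Finset.sum_comm]
  simp only [Matrix.trace, Matrix.diag, Matrix.mul_apply, Finset.mul_sum]
  refine Finset.sum_congr rfl fun t _ => ?_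
  rw [Finset.sum_comm]
  refine Finset.sum_congr rfl fun s _ => ?_
  calc ∑ q, ∑ t', ∑ s', A t s * B t' s' * (pauliPair q s t * pauliPair q s' t')
      = ∑ t', ∑ s', A t s * B t' s' * ∑ q, pauliPair q s t * pauliPair q s' t' := by
        rw [Finset.sum_comm]
        refine Finset.sum_congr rfl fun t' _ => ?_
        rw [Finset.sum_comm]
        simp only [Finset.mul_sum]
    _ = 4 * (A t s * B s t) := by
        simp only [sum_pauliPair_mul_pauliPair]
        rw [Finset.sum_eq_single s, Finset.sum_eq_single t]
        · simp
          ring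
        · intro s' _ hs'
          simp [hs'.symm]
        · simp
        · intro t' _ ht'
          simp [ht'.symm]
        · simp

/-- The operator `∑ Q ⊗ Q` over two-qubit Pauli matrices is invariant under conjugation by
`g ⊗ g`. -/
lemma sum_conj_pauliPair (g : Gate)
    (φ ψ : Matrix (Fin 2 × Fin 2) (Fin 2 × Fin 2) ℂ →ₗ[ℂ] ℂ) :
    ∑ q, φ (g.1ᴴ * pauliPair q * g.1) * ψ (g.1ᴴ * pauliPair q * g.1) =
      ∑ q, φ (pauliPair q) * ψ (pauliPair q) := by
  have hgg : g.1ᴴ * g.1 = 1 := by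
    have := Matrix.mem_unitaryGroup_iff'.1 g.2
    rwa [Matrix.star_eq_conjTranspose] at this
  have repr : ∀ φ : Matrix (Fin 2 × Fin 2) (Fin 2 × Fin 2) ℂ →ₗ[ℂ] ℂ,
      ∃ A : Matrix (Fin 2 × Fin 2) (Fin 2 × Fin 2) ℂ, ∀ M, φ M = (A * M).trace := by
    intro φ
    refine ⟨Matrix.of fun t s => φ (Matrix.single s t 1), fun M => ?_⟩
    conv_lhs => rw [Matrix.matrix_eq_sum_single M]
    rw [Matrix.trace, Finset.sum_comm]
    simp only [map_sum, Matrix.diag, Matrix.mul_apply, Matrix.of_apply]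
    refine Finset.sum_congr rfl fun t _ => Finset.sum_congr rfl fun s _ => ?_
    rw [mul_comm, ← smul_eq_mul, ← map_smul, Matrix.smul_single, smul_eq_mul, mul_one]
  obtain ⟨A, hA⟩ := repr φ
  obtain ⟨B, hB⟩ := repr ψ
  have cyc : ∀ (A M : Matrix (Fin 2 × Fin 2) (Fin 2 × Fin 2) ℂ),
      (A * (g.1ᴴ * M * g.1)).trace = (g.1 * A * g.1ᴴ * M).trace := by
    intro A M
    rw [← mul_assoc, Matrix.trace_mul_comm]
    simp only [mul_assoc]
  simp only [hA, hB, cyc, sum_trace_mul_pauliPair]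
  have : g.1 * A * g.1ᴴ * (g.1 * B * g.1ᴴ) = g.1 * (A * B) * g.1ᴴ := by
    calc _ = g.1 * A * (g.1ᴴ * g.1) * B * g.1ᴴ := by simp only [mul_assoc]
      _ = _ := by rw [hgg]; simp only [mul_assoc, one_mul]
  rw [this, Matrix.trace_mul_comm, ← mul_assoc, hgg, one_mul]

/-! ### Operators on a pair of qubits inside an `n`-qubit register -/

/-- The qubits other than `a` and `b`. -/
abbrev Rest {n : ℕ} (a b : Fin n) : Type := {i : Fin n // i ≠ a ∧ i ≠ b}

/-- The operator acting as `M` on the qubits `a, b` and as `f i` on every other qubit `i`. -/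
def pairOp {n : ℕ} (a b : Fin n) (M : Matrix (Fin 2 × Fin 2) (Fin 2 × Fin 2) ℂ)
    (f : Fin n → Matrix (Fin 2) (Fin 2) ℂ) : Matrix (Fin n → Fin 2) (Fin n → Fin 2) ℂ :=
  Matrix.of fun x y => M (x a, x b) (y a, y b) * ∏ i : Rest a b, f i (x i) (y i)

/-- Splitting a bitstring into its bits at `a, b` and the remaining bits. -/
def splitPair {n : ℕ} {a b : Fin n} (hab : a ≠ b) :
    (Fin n → Fin 2) ≃ (Fin 2 × Fin 2) × (Rest a b → Fin 2) where
  toFun x := ((x a, x b), fun i => x i)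
  invFun p i := if h : i ≠ a ∧ i ≠ b then p.2 ⟨i, h⟩ else if i = a then p.1.1 else p.1.2
  left_inv x := by
    funext i
    by_cases ha : i = a
    · simp [ha]
    · by_cases hb : i = b
      · simp [hb, hab.symm]
      · simp [ha, hb]
  right_inv p := by
    obtain ⟨⟨s, t⟩, r⟩ := p
    simp only [Prod.mk.injEq]
    refine ⟨⟨by simp, by simp [hab.symm]⟩, ?_⟩
    funext i
    simp [i.2.1, i.2.2]

lemma pairOp_mul {n : ℕ} {a b : Fin n} (hab : a ≠ b)
    (M M' : Matrix (Fin 2 × Fin 2) (Fin 2 × Fin 2) ℂ)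
    (f f' : Fin n → Matrix (Fin 2) (Fin 2) ℂ) :
    pairOp a b M f * pairOp a b M' f' = pairOp a b (M * M') (f * f') := by
  ext x y
  rw [Matrix.mul_apply, ← (splitPair hab).symm.sum_comp]
  have hz : ∀ p : (Fin 2 × Fin 2) × (Rest a b → Fin 2),
      pairOp a b M f x ((splitPair hab).symm p) * pairOp a b M' f' ((splitPair hab).symm p) y =
      (M (x a, x b) p.1 * M' p.1 (y a, y b)) *
        ∏ i : Rest a b, f i (x i) (p.2 i) * f' i (p.2 i) (y i) := by
    intro p
    obtain ⟨z, rfl⟩ := (splitPair hab).surjective p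
    rw [Equiv.symm_apply_apply, Finset.prod_mul_distrib]
    simp only [pairOp, splitPair, Matrix.of_apply, Equiv.coe_fn_mk]
    ring
  simp only [hz]
  rw [Fintype.sum_prod_type]
  simp only [← Finset.mul_sum, ← Finset.sum_mul, pairOp, Matrix.of_apply, Matrix.mul_apply,
    Pi.mul_apply]
  rw [Finset.prod_univ_sum, Fintype.piFinset_univ]

lemma applyGate_eq_pairOp {n : ℕ} (a b : Fin n)
    (g : Matrix (Fin 2 × Fin 2) (Fin 2 × Fin 2) ℂ) :
    applyGate a b g = pairOp a b g 1 := by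
  ext x y
  simp only [applyGate, pairOp, Matrix.of_apply, Pi.one_apply, Matrix.one_apply]
  rw [mul_comm, Finset.prod_ite_zero]
  simp

lemma applyGate_mul {n : ℕ} {a b : Fin n} (hab : a ≠ b)
    (g h : Matrix (Fin 2 × Fin 2) (Fin 2 × Fin 2) ℂ) :
    applyGate a b (g * h) = applyGate a b g * applyGate a b h := by
  simp only [applyGate_eq_pairOp, pairOp_mul hab, mul_one]

lemma applyGate_conjTranspose {n : ℕ} (a b : Fin n)
    (g : Matrix (Fin 2 × Fin 2) (Fin 2 × Fin 2) ℂ) :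
    (applyGate a b g)ᴴ = applyGate a b gᴴ := by
  ext x y
  simp only [applyGate, Matrix.conjTranspose_apply, Matrix.of_apply, star_mul']
  congr 1
  simp only [eq_comm (a := y _)]
  split_ifs <;> simp

lemma applyGate_one {n : ℕ} {a b : Fin n} :
    applyGate a b (1 : Matrix (Fin 2 × Fin 2) (Fin 2 × Fin 2) ℂ) = 1 := by
  ext x y
  simp only [applyGate, Matrix.of_apply, Matrix.one_apply, Prod.mk.injEq, mul_ite, mul_one,
    mul_zero, ← ite_and]
  congr 1
  rw [funext_iff, eq_iff_iff]
  constructor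
  · rintro ⟨⟨ha, hb⟩, h⟩ i
    by_cases hia : i = a
    · rw [hia, ha]
    · by_cases hib : i = b
      · rw [hib, hb]
      · exact h i hia hib
  · exact fun h => ⟨⟨h a, h b⟩, fun i _ _ => h i⟩

/-- The `n`-qubit Pauli operator with labels `P`. -/
def pauliN {n : ℕ} (P : Fin n → Fin 4) : Matrix (Fin n → Fin 2) (Fin n → Fin 2) ℂ :=
  Matrix.of fun x y => ∏ i, pauli (P i) (x i) (y i)

/-- Relabelling a Pauli string on the qubits `a, b`. -/
def setPair {n : ℕ} (a b : Fin n) (P : Fin n → Fin 4) (q : Fin 4 × Fin 4) : Fin n → Fin 4 :=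
  Function.update (Function.update P a q.1) b q.2

lemma setPair_self {n : ℕ} (a b : Fin n) (P : Fin n → Fin 4) :
    setPair a b P (P a, P b) = P := by
  simp [setPair]

lemma pauliN_setPair {n : ℕ} {a b : Fin n} (hab : a ≠ b) (P : Fin n → Fin 4)
    (q : Fin 4 × Fin 4) :
    pauliN (setPair a b P q) = pairOp a b (pauliPair q) (fun i => pauli (P i)) := by
  ext x y
  have hb : b ∈ Finset.univ.erase a := by simp [hab.symm]
  rw [pauliN, Matrix.of_apply, ← Finset.mul_prod_erase _ _ (Finset.mem_univ a),
    ← Finset.mul_prod_erase _ _ hb, Finset.prod_subtype (p := fun i => i ≠ a ∧ i ≠ b) _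
      (by intro i; simp [and_comm])]
  simp only [pairOp, Matrix.of_apply, pauliPair, Matrix.kroneckerMap_apply, setPair, mul_assoc]
  congr 1
  · simp [hab]
  congr 1
  · simp
  refine Finset.prod_congr rfl fun i _ => ?_
  simp [i.2.1, i.2.2]

/-- The expectation of the Pauli operator `P` in the (unnormalized) state `v`. -/
def pauliExp {n : ℕ} (P : Fin n → Fin 4) (v : (Fin n → Fin 2) → ℂ) : ℂ :=
  star v ⬝ᵥ (pauliN P *ᵥ v)

/-- The expectation of `pairOp a b M f` in the state `v`, as a functional of `M`. -/
def pairFunctional {n : ℕ} (a b : Fin n) (f : Fin n → Matrix (Fin 2) (Fin 2) ℂ)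
    (v : (Fin n → Fin 2) → ℂ) : Matrix (Fin 2 × Fin 2) (Fin 2 × Fin 2) ℂ →ₗ[ℂ] ℂ where
  toFun M := star v ⬝ᵥ (pairOp a b M f *ᵥ v)
  map_add' M N := by
    rw [← dotProduct_add, ← Matrix.add_mulVec]
    congr 2
    ext x y
    simp [pairOp, add_mul]
  map_smul' c M := by
    rw [RingHom.id_apply, ← dotProduct_smul, ← Matrix.smul_mulVec]
    congr 2
    ext x y
    simp [pairOp, mul_assoc]

lemma pauliExp_setPair {n : ℕ} {a b : Fin n} (hab : a ≠ b) (P : Fin n → Fin 4)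
    (q : Fin 4 × Fin 4) (v : (Fin n → Fin 2) → ℂ) :
    pauliExp (setPair a b P q) v =
      pairFunctional a b (fun i => pauli (P i)) v (pauliPair q) := by
  rw [pauliExp, pauliN_setPair hab]
  rfl

lemma pauliExp_setPair_applyGate {n : ℕ} {a b : Fin n} (hab : a ≠ b) (P : Fin n → Fin 4)
    (q : Fin 4 × Fin 4) (g : Matrix (Fin 2 × Fin 2) (Fin 2 × Fin 2) ℂ)
    (v : (Fin n → Fin 2) → ℂ) :
    pauliExp (setPair a b P q) (applyGate a b g *ᵥ v) =
      pairFunctional a b (fun i => pauli (P i)) v (gᴴ * pauliPair q * g) := by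
  change _ = star v ⬝ᵥ (pairOp a b (gᴴ * pauliPair q * g) (fun i => pauli (P i)) *ᵥ v)
  have h : pairOp a b (gᴴ * pauliPair q * g) (fun i => pauli (P i)) =
      (applyGate a b g)ᴴ * pauliN (setPair a b P q) * applyGate a b g := by
    rw [applyGate_conjTranspose, pauliN_setPair hab, applyGate_eq_pairOp, applyGate_eq_pairOp,
      pairOp_mul hab, pairOp_mul hab, one_mul, mul_one]
  rw [h, pauliExp, Matrix.star_mulVec, ← Matrix.mulVec_mulVec, ← Matrix.mulVec_mulVec,
    Matrix.dotProduct_mulVec (star v)]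

/-- Two-copy Pauli expectation of the pair of states `v, w`. -/
def pauliCorr {n : ℕ} (P : Fin n → Fin 4) (v w : (Fin n → Fin 2) → ℂ) : ℝ :=
  (pauliExp P v * pauliExp P w).re

lemma pauliExp_applyGate_of_trivial {n : ℕ} {a b : Fin n} (hab : a ≠ b) (P : Fin n → Fin 4)
    (g : Gate) (v : (Fin n → Fin 2) → ℂ) :
    pauliExp (setPair a b P 0) (applyGate a b g.1 *ᵥ v) = pauliExp (setPair a b P 0) v := by
  have hgg : g.1ᴴ * g.1 = 1 := by
    have := Matrix.mem_unitaryGroup_iff'.1 g.2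
    rwa [Matrix.star_eq_conjTranspose] at this
  have h0 : pauliPair 0 = 1 := by
    simp [pauliPair, pauli]
  rw [pauliExp_setPair_applyGate hab, pauliExp_setPair hab, h0, mul_one, hgg]

lemma sum_pauliCorr_applyGate {n : ℕ} {a b : Fin n} (hab : a ≠ b) (P : Fin n → Fin 4)
    (g : Gate) (v w : (Fin n → Fin 2) → ℂ) :
    ∑ q ∈ Finset.univ.erase (0 : Fin 4 × Fin 4),
      pauliCorr (setPair a b P q) (applyGate a b g.1 *ᵥ v) (applyGate a b g.1 *ᵥ w) =
    ∑ q ∈ Finset.univ.erase (0 : Fin 4 × Fin 4), pauliCorr (setPair a b P q) v w := by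
  have key : ∑ q, pauliCorr (setPair a b P q) (applyGate a b g.1 *ᵥ v) (applyGate a b g.1 *ᵥ w) =
      ∑ q, pauliCorr (setPair a b P q) v w := by
    simp only [pauliCorr, ← Complex.re_sum]
    congr 1
    simp only [pauliExp_setPair_applyGate hab, pauliExp_setPair hab]
    exact sum_conj_pauliPair g _ _
  rw [← Finset.add_sum_erase _ _ (Finset.mem_univ (0 : Fin 4 × Fin 4)),
    ← Finset.add_sum_erase (Finset.univ) (fun q => pauliCorr (setPair a b P q) v w)
      (Finset.mem_univ (0 : Fin 4 × Fin 4))] at key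
  have h0 : pauliCorr (setPair a b P 0) (applyGate a b g.1 *ᵥ v) (applyGate a b g.1 *ᵥ w) =
      pauliCorr (setPair a b P 0) v w := by
    simp only [pauliCorr, pauliExp_applyGate_of_trivial hab]
  rw [h0] at key
  exact add_left_cancel key

lemma exists_gate_pauliExp {n : ℕ} {a b : Fin n} (hab : a ≠ b) (P : Fin n → Fin 4)
    {p q : Fin 4 × Fin 4} (hp : p ≠ 0) (hq : q ≠ 0) :
    ∃ h : Gate, ∀ v, pauliExp (setPair a b P p) (applyGate a b h.1 *ᵥ v) =
      pauliExp (setPair a b P q) v := by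
  obtain ⟨h, hh⟩ := exists_gate_conj p q hp hq
  exact ⟨h, fun v => by rw [pauliExp_setPair_applyGate hab, pauliExp_setPair hab, hh]⟩

lemma exists_gate_pauliExp_neg {n : ℕ} {a b : Fin n} (hab : a ≠ b) (P : Fin n → Fin 4)
    {p : Fin 4 × Fin 4} (hp : p ≠ 0) :
    ∃ h : Gate, ∀ v, pauliExp (setPair a b P p) (applyGate a b h.1 *ᵥ v) =
      -pauliExp (setPair a b P p) v := by
  obtain ⟨h, hh⟩ := exists_gate_conj_neg p hp
  exact ⟨h, fun v => by rw [pauliExp_setPair_applyGate hab, pauliExp_setPair hab, hh, map_neg]⟩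

/-! ### The cross-entropy score as a sum of Pauli correlations -/

/-- The Pauli string with `Z` on the qubits of `T` and the identity elsewhere. -/
def zString {n : ℕ} (T : Finset (Fin n)) : Fin n → Fin 4 := fun i => if i ∈ T then 3 else 0

/-- The eigenvalues of `Z`. -/
def zSign (s : Fin 2) : ℝ := if s = 0 then 1 else -1

lemma pauliN_zString {n : ℕ} (T : Finset (Fin n)) :
    pauliN (zString T) = Matrix.diagonal fun x => ((∏ i ∈ T, zSign (x i) : ℝ) : ℂ) := by
  ext x y
  have hfac : ∀ i, pauli (zString T i) (x i) (y i) =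
      if x i = y i then (if i ∈ T then (zSign (x i) : ℂ) else 1) else 0 := by
    intro i
    unfold zString zSign
    generalize x i = s
    generalize y i = t
    by_cases hi : i ∈ T <;> fin_cases s <;> fin_cases t <;> simp [pauli, hi]
  rw [pauliN, Matrix.of_apply, Finset.prod_congr rfl fun i _ => hfac i, Finset.prod_ite_zero,
    Matrix.diagonal_apply]
  simp only [Finset.mem_univ, forall_const, ← funext_iff]
  congr 1
  rw [Complex.ofReal_prod, Finset.prod_ite_mem, Finset.univ_inter]

lemma pauliExp_zString {n : ℕ} (T : Finset (Fin n)) (v : (Fin n → Fin 2) → ℂ) :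
    pauliExp (zString T) v = ((∑ x, (∏ i ∈ T, zSign (x i)) * Complex.normSq (v x) : ℝ) : ℂ) := by
  rw [pauliExp, pauliN_zString, dotProduct, Complex.ofReal_sum]
  refine Finset.sum_congr rfl fun x _ => ?_
  rw [Matrix.mulVec_diagonal, Complex.ofReal_mul, Complex.normSq_eq_conj_mul_self, Pi.star_apply,
    Complex.star_def]
  ring

lemma sum_prod_zSign {n : ℕ} (x y : Fin n → Fin 2) :
    ∑ T : Finset (Fin n), (∏ i ∈ T, zSign (x i)) * ∏ i ∈ T, zSign (y i) =
      if x = y then 2 ^ n else 0 := by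
  simp only [← Finset.prod_mul_distrib]
  rw [← Finset.powerset_univ, ← Finset.prod_one_add]
  have hfac : ∀ s t : Fin 2, 1 + zSign s * zSign t = if s = t then 2 else 0 := by
    intro s t
    fin_cases s <;> fin_cases t <;> norm_num [zSign]
  simp only [hfac]
  rw [Finset.prod_ite_zero]
  simp [← funext_iff]

/-- Collision score of two states in terms of `Z`-type Pauli correlations. -/
lemma sum_normSq_mul_normSq {n : ℕ} (v w : (Fin n → Fin 2) → ℂ) :
    2 ^ n * ∑ x, Complex.normSq (v x) * Complex.normSq (w x) =
      ∑ T : Finset (Fin n), pauliCorr (zString T) v w := by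
  have h : ∀ T : Finset (Fin n), pauliCorr (zString T) v w =
      ∑ x, ∑ y, ((∏ i ∈ T, zSign (x i)) * ∏ i ∈ T, zSign (y i)) *
        (Complex.normSq (v x) * Complex.normSq (w y)) := by
    intro T
    rw [pauliCorr, pauliExp_zString, pauliExp_zString, ← Complex.ofReal_mul, Complex.ofReal_re,
      Finset.sum_mul_sum]
    refine Finset.sum_congr rfl fun x _ => Finset.sum_congr rfl fun y _ => ?_
    ring
  simp only [h]
  rw [Finset.sum_comm, Finset.mul_sum]
  refine Finset.sum_congr rfl fun x _ => ?_
  rw [Finset.sum_comm]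
  simp only [← Finset.sum_mul, sum_prod_zSign]
  simp

lemma pauliExp_single_zero {n : ℕ} (P : Fin n → Fin 4) :
    pauliExp P (Pi.single (fun _ => 0) 1) =
      ((∏ i, (if P i = 0 ∨ P i = 3 then 1 else 0) : ℝ) : ℂ) := by
  have hfac : ∀ p : Fin 4, pauli p 0 0 = ((if p = 0 ∨ p = 3 then 1 else 0 : ℝ) : ℂ) := by
    intro p
    fin_cases p <;> simp [pauli]
  have hs : star (Pi.single (fun _ => 0) 1 : (Fin n → Fin 2) → ℂ) = Pi.single (fun _ => 0) 1 := by
    rw [Pi.star_single, star_one]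
  rw [pauliExp, hs, single_one_dotProduct, Matrix.mulVec_single_one, Matrix.col_apply, pauliN,
    Matrix.of_apply, Complex.ofReal_prod]
  exact Finset.prod_congr rfl fun i _ => hfac _

lemma pauliCorr_single_zero_nonneg {n : ℕ} (P : Fin n → Fin 4) :
    0 ≤ pauliCorr P (Pi.single (fun _ => 0) 1) (Pi.single (fun _ => 0) 1) := by
  rw [pauliCorr, pauliExp_single_zero, ← Complex.ofReal_mul, Complex.ofReal_re]
  exact mul_self_nonneg _

lemma pauliCorr_zString_single_zero {n : ℕ} (T : Finset (Fin n)) :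
    pauliCorr (zString T) (Pi.single (fun _ => 0) 1) (Pi.single (fun _ => 0) 1) = 1 := by
  rw [pauliCorr, pauliExp_single_zero, ← Complex.ofReal_mul, Complex.ofReal_re,
    Finset.prod_eq_one, mul_one]
  intro i _
  rw [if_pos]
  unfold zString
  split_ifs <;> simp

/-! ### Averaging over Haar-random gates -/

instance : SecondCountableTopology Gate :=
  inferInstanceAs (SecondCountableTopology
    {M : (Fin 2 × Fin 2) → (Fin 2 × Fin 2) → ℂ // M ∈ Matrix.unitaryGroup (Fin 2 × Fin 2) ℂ})

instance : CompactSpace Gate := by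
  have hclosed : IsClosed (Matrix.unitaryGroup (Fin 2 × Fin 2) ℂ :
      Set (Matrix (Fin 2 × Fin 2) (Fin 2 × Fin 2) ℂ)) := by
    have : (Matrix.unitaryGroup (Fin 2 × Fin 2) ℂ :
        Set (Matrix (Fin 2 × Fin 2) (Fin 2 × Fin 2) ℂ)) = {M | M * star M = 1} := by
      ext M
      exact Matrix.mem_unitaryGroup_iff
    rw [this]
    exact isClosed_eq (by fun_prop) continuous_const
  refine isCompact_iff_compactSpace.1 (IsCompact.of_isClosed_subset
    (isCompact_univ_pi fun _ => isCompact_univ_pi fun _ => isCompact_closedBall (0 : ℂ) 1)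
    hclosed ?_)
  intro M hM i _ j _
  rw [mem_closedBall_zero_iff]
  exact entry_norm_bound_of_unitary hM i j

section Averaging

variable {n d m : ℕ}

/-- The state obtained from `|0ⁿ⟩` by applying the gates `f k` to the qubits `a k, b k`, for `k`
ranging over a list. -/
def runState (a b : Fin d × Fin m → Fin n)
    (f : Fin d × Fin m → Matrix (Fin 2 × Fin 2) (Fin 2 × Fin 2) ℂ) (L : List (Fin d × Fin m)) :
    (Fin n → Fin 2) → ℂ :=
  (L.map fun k => applyGate (a k) (b k) (f k)).prod *ᵥ Pi.single (fun _ => 0) 1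

lemma runState_cons (a b : Fin d × Fin m → Fin n)
    (f : Fin d × Fin m → Matrix (Fin 2 × Fin 2) (Fin 2 × Fin 2) ℂ) (k : Fin d × Fin m)
    (L : List (Fin d × Fin m)) :
    runState a b f (k :: L) = applyGate (a k) (b k) (f k) *ᵥ runState a b f L := by
  rw [runState, runState, List.map_cons, List.prod_cons, Matrix.mulVec_mulVec]

lemma runState_nil (a b : Fin d × Fin m → Fin n)
    (f : Fin d × Fin m → Matrix (Fin 2 × Fin 2) (Fin 2 × Fin 2) ℂ) :
    runState a b f [] = Pi.single (fun _ => 0) 1 := by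
  rw [runState, List.map_nil, List.prod_nil, Matrix.one_mulVec]

lemma runState_congr (a b : Fin d × Fin m → Fin n)
    {f f' : Fin d × Fin m → Matrix (Fin 2 × Fin 2) (Fin 2 × Fin 2) ℂ}
    {L : List (Fin d × Fin m)} (h : ∀ k ∈ L, f k = f' k) :
    runState a b f L = runState a b f' L := by
  rw [runState, runState, List.map_congr_left fun k hk => by rw [h k hk]]

/-- The matrices of all gates. -/
def fullGates (g : Fin d → Fin m → Gate) (k : Fin d × Fin m) :
    Matrix (Fin 2 × Fin 2) (Fin 2 × Fin 2) ℂ := (g k.1 k.2).1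

/-- The matrices of the gates, those not satisfying `keep` being replaced by the identity. -/
def keptGates (keep : Fin d × Fin m → Prop) (g : Fin d → Fin m → Gate) (k : Fin d × Fin m) :
    Matrix (Fin 2 × Fin 2) (Fin 2 × Fin 2) ℂ := if keep k then (g k.1 k.2).1 else 1

lemma continuous_runState (a b : Fin d × Fin m → Fin n) {X : Type*} [TopologicalSpace X]
    {f : X → Fin d × Fin m → Matrix (Fin 2 × Fin 2) (Fin 2 × Fin 2) ℂ}
    (hf : Continuous f) (L : List (Fin d × Fin m)) :
    Continuous fun g => runState a b (f g) L := by
  induction L with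
  | nil => simpa only [runState_nil] using continuous_const
  | cons k L ih =>
    simp only [runState_cons]
    refine Continuous.matrix_mulVec (continuous_matrix fun x y => ?_) ih
    simp only [applyGate, Matrix.of_apply]
    exact continuous_const.mul (((continuous_apply k).comp hf).matrix_elem _ _)

lemma continuous_fullGates :
    Continuous (fullGates : (Fin d → Fin m → Gate) → _) := by
  unfold fullGates
  fun_prop

lemma continuous_keptGates (keep : Fin d × Fin m → Prop) :
    Continuous (keptGates keep : (Fin d → Fin m → Gate) → _) := by
  refine continuous_pi fun k => ?_
  by_cases hk : keep k
  · simp only [keptGates, hk, if_true]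
    fun_prop
  · simpa only [keptGates, hk, if_false] using continuous_const

/-- Pauli correlation between the truncated and the full circuit on the gates of a list. -/
def circCorr (a b : Fin d × Fin m → Fin n) (keep : Fin d × Fin m → Prop)
    (L : List (Fin d × Fin m)) (P : Fin n → Fin 4) (g : Fin d → Fin m → Gate) : ℝ :=
  pauliCorr P (runState a b (keptGates keep g) L) (runState a b (fullGates g) L)

lemma continuous_circCorr (a b : Fin d × Fin m → Fin n) (keep : Fin d × Fin m → Prop)
    (L : List (Fin d × Fin m)) (P : Fin n → Fin 4) : Continuous (circCorr a b keep L P) := by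
  have h1 := continuous_runState a b (continuous_keptGates keep) L
  have h2 := continuous_runState a b continuous_fullGates L
  have hE : Continuous (pauliExp P) := by
    unfold pauliExp
    exact continuous_star.dotProduct (continuous_const.matrix_mulVec continuous_id)
  exact Complex.continuous_re.comp ((hE.comp h1).mul (hE.comp h2))

/-- Left translation of a single gate. -/
def gateAt (k : Fin d × Fin m) (h : Gate) : Fin d → Fin m → Gate :=
  Pi.mulSingle k.1 (Pi.mulSingle k.2 h)

lemma gateAt_mul_same (k : Fin d × Fin m) (h : Gate) (g : Fin d → Fin m → Gate) :
    (gateAt k h * g) k.1 k.2 = h * g k.1 k.2 := by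
  simp [gateAt]

lemma gateAt_mul_of_ne {k k' : Fin d × Fin m} (hk : k' ≠ k) (h : Gate)
    (g : Fin d → Fin m → Gate) : (gateAt k h * g) k'.1 k'.2 = g k'.1 k'.2 := by
  by_cases h1 : k'.1 = k.1
  · have h2 : k'.2 ≠ k.2 := fun h2 => hk (Prod.ext h1 h2)
    simp [gateAt, h1, h2]
  · simp [gateAt, h1]

variable {a b : Fin d × Fin m → Fin n} {keep : Fin d × Fin m → Prop}
  {k : Fin d × Fin m} {L : List (Fin d × Fin m)}

lemma runState_full_gateAt (hab : a k ≠ b k) (hk : k ∉ L) (h : Gate) (g : Fin d → Fin m → Gate) :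
    runState a b (fullGates (gateAt k h * g)) (k :: L) =
      applyGate (a k) (b k) h.1 *ᵥ runState a b (fullGates g) (k :: L) := by
  have ht : runState a b (fullGates (gateAt k h * g)) L = runState a b (fullGates g) L :=
    runState_congr a b fun k' hk' => by
      rw [fullGates, fullGates, gateAt_mul_of_ne (ne_of_mem_of_not_mem hk' hk)]
  rw [runState_cons, runState_cons, ht, Matrix.mulVec_mulVec, ← applyGate_mul hab, fullGates,
    gateAt_mul_same]
  rfl

lemma runState_kept_gateAt (hab : a k ≠ b k) (hk : k ∉ L) (h : Gate) (g : Fin d → Fin m → Gate) :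
    runState a b (keptGates keep (gateAt k h * g)) (k :: L) =
      applyGate (a k) (b k) (if keep k then h.1 else 1) *ᵥ
        runState a b (keptGates keep g) (k :: L) := by
  have ht : runState a b (keptGates keep (gateAt k h * g)) L =
      runState a b (keptGates keep g) L :=
    runState_congr a b fun k' hk' => by
      rw [keptGates, keptGates, gateAt_mul_of_ne (ne_of_mem_of_not_mem hk' hk)]
  rw [runState_cons, runState_cons, ht, Matrix.mulVec_mulVec, ← applyGate_mul hab, keptGates,
    keptGates, gateAt_mul_same]
  split_ifs
  · rfl
  · rw [one_mul]

lemma circCorr_cons_of_trivial (hab : a k ≠ b k) (P : Fin n → Fin 4)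
    (g : Fin d → Fin m → Gate) :
    circCorr a b keep (k :: L) (setPair (a k) (b k) P 0) g =
      circCorr a b keep L (setPair (a k) (b k) P 0) g := by
  simp only [circCorr, pauliCorr, runState_cons, fullGates, keptGates]
  rw [pauliExp_applyGate_of_trivial hab]
  split_ifs
  · rw [pauliExp_applyGate_of_trivial hab]
  · rw [applyGate_one, Matrix.one_mulVec]

variable (μ : Measure (Fin d → Fin m → Gate))

lemma integrable_circCorr [IsProbabilityMeasure μ] (a b : Fin d × Fin m → Fin n) (keep : Fin d × Fin m → Prop)
    (L : List (Fin d × Fin m)) (P : Fin n → Fin 4) : Integrable (circCorr a b keep L P) μ :=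
  (continuous_circCorr a b keep L P).integrable_of_hasCompactSupport
    (HasCompactSupport.of_compactSpace _)

variable [μ.IsMulLeftInvariant]

/-- A removed gate annihilates every Pauli string acting nontrivially on its qubits. -/
lemma integral_circCorr_cons_of_not_keep (hab : a k ≠ b k) (hk : k ∉ L) (hkeep : ¬ keep k)
    (P : Fin n → Fin 4) {p : Fin 4 × Fin 4} (hp : p ≠ 0) :
    ∫ g, circCorr a b keep (k :: L) (setPair (a k) (b k) P p) g ∂μ = 0 := by
  obtain ⟨h, hh⟩ := exists_gate_pauliExp_neg hab P hp
  have key := integral_mul_left_eq_self (μ := μ)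
    (circCorr a b keep (k :: L) (setPair (a k) (b k) P p)) (gateAt k h)
  have hneg : ∀ g, circCorr a b keep (k :: L) (setPair (a k) (b k) P p) (gateAt k h * g) =
      -circCorr a b keep (k :: L) (setPair (a k) (b k) P p) g := by
    intro g
    rw [circCorr, circCorr, pauliCorr, pauliCorr, runState_full_gateAt hab hk,
      runState_kept_gateAt hab hk, if_neg hkeep, applyGate_one, Matrix.one_mulVec, hh]
    simp only [mul_neg, Complex.neg_re]
  simp only [hneg, integral_neg] at key
  linarith

/-- A kept gate averages a nontrivial Pauli string over all nontrivial Pauli strings on its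
qubits. -/
lemma integral_circCorr_cons_of_keep [IsProbabilityMeasure μ] (hab : a k ≠ b k) (hk : k ∉ L)
    (hkeep : keep k)
    (P : Fin n → Fin 4) {p : Fin 4 × Fin 4} (hp : p ≠ 0) :
    ∫ g, circCorr a b keep (k :: L) (setPair (a k) (b k) P p) g ∂μ =
      1 / 15 * ∑ q ∈ Finset.univ.erase (0 : Fin 4 × Fin 4),
        ∫ g, circCorr a b keep L (setPair (a k) (b k) P q) g ∂μ := by
  have heq : ∀ q ∈ Finset.univ.erase (0 : Fin 4 × Fin 4),
      ∫ g, circCorr a b keep (k :: L) (setPair (a k) (b k) P q) g ∂μ =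
        ∫ g, circCorr a b keep (k :: L) (setPair (a k) (b k) P p) g ∂μ := by
    intro q hq
    obtain ⟨h, hh⟩ := exists_gate_pauliExp hab P hp (Finset.ne_of_mem_erase hq)
    rw [← integral_mul_left_eq_self (μ := μ)
      (circCorr a b keep (k :: L) (setPair (a k) (b k) P p)) (gateAt k h)]
    refine integral_congr_ae (Filter.Eventually.of_forall fun g => ?_)
    simp only [circCorr, pauliCorr]
    rw [runState_full_gateAt hab hk, runState_kept_gateAt hab hk, if_pos hkeep, hh, hh]
  have hsum : ∑ q ∈ Finset.univ.erase (0 : Fin 4 × Fin 4),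
      ∫ g, circCorr a b keep (k :: L) (setPair (a k) (b k) P q) g ∂μ =
      ∑ q ∈ Finset.univ.erase (0 : Fin 4 × Fin 4),
        ∫ g, circCorr a b keep L (setPair (a k) (b k) P q) g ∂μ := by
    rw [← integral_finsetSum _ fun q _ => integrable_circCorr μ a b keep _ _,
      ← integral_finsetSum _ fun q _ => integrable_circCorr μ a b keep _ _]
    refine integral_congr_ae (Filter.Eventually.of_forall fun g => ?_)
    simp only [circCorr, runState_cons, keptGates, hkeep, if_true]
    exact sum_pauliCorr_applyGate hab P (g k.1 k.2) _ _
  rw [← hsum, Finset.sum_congr rfl heq, Finset.sum_const, Finset.card_erase_of_mem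
    (Finset.mem_univ _)]
  simp

lemma integral_circCorr_nonneg [IsProbabilityMeasure μ] (hab : ∀ k, a k ≠ b k) (hL : L.Nodup)
    (P : Fin n → Fin 4) :
    0 ≤ ∫ g, circCorr a b keep L P g ∂μ := by
  induction L generalizing P with
  | nil =>
    simp only [circCorr, runState_nil]
    exact integral_nonneg fun _ => pauliCorr_single_zero_nonneg P
  | cons k L ih =>
    rw [List.nodup_cons] at hL
    rw [← setPair_self (a k) (b k) P]
    by_cases hp : (P (a k), P (b k)) = 0
    · simp only [hp, circCorr_cons_of_trivial (hab k)]
      exact ih hL.2 _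
    by_cases hkeep : keep k
    · rw [integral_circCorr_cons_of_keep μ (hab k) hL.1 hkeep P hp]
      exact mul_nonneg (by norm_num) (Finset.sum_nonneg fun q _ => ih hL.2 _)
    · rw [integral_circCorr_cons_of_not_keep μ (hab k) hL.1 hkeep P hp]

/-- If every gate touching `T` is kept, each of them costs at most a factor `1/15`. -/
lemma le_integral_circCorr_zString [IsProbabilityMeasure μ] (hab : ∀ k, a k ≠ b k) (hL : L.Nodup)
    (T : Finset (Fin n)) (hT : ∀ k, a k ∈ T ∨ b k ∈ T → keep k) :
    (1 / 15 : ℝ) ^ (L.countP fun k => a k ∈ T ∨ b k ∈ T) ≤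
      ∫ g, circCorr a b keep L (zString T) g ∂μ := by
  induction L with
  | nil =>
    simp [circCorr, runState_nil, pauliCorr_zString_single_zero]
  | cons k L ih =>
    rw [List.nodup_cons] at hL
    have ih := ih hL.2
    by_cases hk : a k ∈ T ∨ b k ∈ T
    · have hp : (zString T (a k), zString T (b k)) ≠ 0 := by
        rcases hk with hk | hk <;> simp [zString, hk]
      rw [List.countP_cons_of_pos (by simpa using hk), pow_succ', ← setPair_self (a k) (b k)
        (zString T), integral_circCorr_cons_of_keep μ (hab k) hL.1 (hT k hk) _ hp]
      refine mul_le_mul_of_nonneg_left (ih.trans ?_) (by norm_num)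
      have := Finset.single_le_sum
        (f := fun q => ∫ g, circCorr a b keep L (setPair (a k) (b k) (zString T) q) g ∂μ)
        (fun q _ => integral_circCorr_nonneg μ hab hL.2 _)
        (Finset.mem_erase.2 ⟨hp, Finset.mem_univ _⟩)
      simpa only [setPair_self] using this
    · have hp : (zString T (a k), zString T (b k)) = 0 := by
        rw [not_or] at hk
        simp [zString, hk]
      rw [List.countP_cons_of_neg (by simpa using hk), ← setPair_self (a k) (b k) (zString T), hp]
      simp only [circCorr_cons_of_trivial (hab k)]
      rwa [← hp, setPair_self]

end Averaging

/-! ### The greedy partition -/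

section Greedy

variable {n : ℕ} {adj : Fin n → Fin n → Prop} {d : ℕ}

lemma card_neighbors_neighbors_le (hd : 1 ≤ d) (hsymm : ∀ j k, adj j k → adj k j)
    (hdeg : ∀ j, (Finset.univ.filter fun k => adj j k).card ≤ d) (i : Fin n) :
    (Finset.univ.filter fun j => ∃ k ∈ insert i (Finset.univ.filter fun j => adj i j),
      adj j k).card ≤ d ^ 2 + 1 := by
  set N : Fin n → Finset (Fin n) := fun j => Finset.univ.filter fun k => adj j k with hN
  have hsub : (Finset.univ.filter fun j => ∃ k ∈ insert i (N i), adj j k) ⊆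
      insert i (N i ∪ (N i).biUnion fun k => (N k).erase i) := by
    intro j hj
    obtain ⟨k, hk, hjk⟩ := (Finset.mem_filter.1 hj).2
    by_cases hji : j = i
    · simp [hji]
    rw [Finset.mem_insert] at hk
    rcases hk with rfl | hk
    · simp [hN, hsymm _ _ hjk]
    · refine Finset.mem_insert_of_mem (Finset.mem_union_right _ (Finset.mem_biUnion.2
        ⟨k, hk, Finset.mem_erase.2 ⟨hji, ?_⟩⟩))
      simp [hN, hsymm _ _ hjk]
  have herase : ∀ k ∈ N i, ((N k).erase i).card ≤ d - 1 := by
    intro k hk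
    have hik : i ∈ N k := by
      simp only [hN, Finset.mem_filter, Finset.mem_univ, true_and] at hk ⊢
      exact hsymm _ _ hk
    rw [Finset.card_erase_of_mem hik]
    exact Nat.sub_le_sub_right (hdeg k) 1
  calc _ ≤ (insert i (N i ∪ (N i).biUnion fun k => (N k).erase i)).card := Finset.card_le_card hsub
    _ ≤ (N i ∪ (N i).biUnion fun k => (N k).erase i).card + 1 := Finset.card_insert_le _ _
    _ ≤ ((N i).card + ((N i).biUnion fun k => (N k).erase i).card) + 1 := by
        gcongr
        exact Finset.card_union_le _ _
    _ ≤ (d + d * (d - 1)) + 1 := by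
        gcongr
        · exact hdeg i
        · exact (Finset.card_biUnion_le_card_mul _ _ _ herase).trans
            (Nat.mul_le_mul_right _ (hdeg i))
    _ = d ^ 2 + 1 := by
        obtain ⟨e, rfl⟩ := Nat.exists_eq_add_of_le hd
        simp only [Nat.add_sub_cancel_left]
        ring

lemma exists_greedy_centers (hd : 1 ≤ d) (hsymm : ∀ j k, adj j k → adj k j)
    (hdeg : ∀ j, (Finset.univ.filter fun k => adj j k).card ≤ d) (hex : ∀ j, ∃ k, adj j k)
    (fuel : ℕ) (G : Finset (Fin n)) (hG : G.card ≤ fuel) :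
    ∃ S ⊆ G, (∀ c ∈ S, insert c (Finset.univ.filter fun j => adj c j) ∈ greedyAux n adj fuel G) ∧
      G.card ≤ S.card * (d ^ 2 + 1) := by
  induction fuel generalizing G with
  | zero => exact ⟨∅, by simp, by simp, by simpa using hG⟩
  | succ fuel ih =>
    by_cases h : G.Nonempty
    · set i := G.min' h with hi
      set P : Finset (Fin n) := insert i (Finset.univ.filter fun j => adj i j) with hP
      set D : Finset (Fin n) := Finset.univ.filter fun j => ∃ k ∈ P, adj j k with hD
      have hstep : greedyAux n adj (fuel + 1) G = insert P (greedyAux n adj fuel (G \ D)) := by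
        rw [greedyAux, dif_pos h]
      have hiD : i ∈ D := by
        obtain ⟨k, hk⟩ := hex i
        simp only [hD, hP, Finset.mem_filter, Finset.mem_univ, true_and]
        exact ⟨k, by simp [hk], hk⟩
      have hcard : (G \ D).card ≤ fuel := by
        have : (G \ D).card < G.card := Finset.card_lt_card
          (Finset.ssubset_iff_of_subset Finset.sdiff_subset |>.2
            ⟨i, G.min'_mem h, by simp [hiD]⟩)
        omega
      obtain ⟨S, hSG, hS, hle⟩ := ih (G \ D) hcard
      have hiS : i ∉ S := fun hmem => (Finset.mem_sdiff.1 (hSG hmem)).2 hiD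
      refine ⟨insert i S, ?_, ?_, ?_⟩
      · exact Finset.insert_subset (G.min'_mem h) (hSG.trans Finset.sdiff_subset)
      · intro c hc
        rw [hstep]
        rcases Finset.mem_insert.1 hc with rfl | hc
        · exact Finset.mem_insert_self _ _
        · exact Finset.mem_insert_of_mem (hS c hc)
      · have h1 : G.card ≤ (G \ D).card + D.card := by
          have := Finset.le_card_sdiff D G
          omega
        have h2 : D.card ≤ d ^ 2 + 1 := card_neighbors_neighbors_le hd hsymm hdeg i
        rw [Finset.card_insert_of_notMem hiS, add_mul, one_mul]
        omega
    · rw [Finset.not_nonempty_iff_eq_empty] at h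
      exact ⟨∅, by simp, by simp, by simp [h]⟩

end Greedy

/-! ### The interaction graph of a circuit -/

section Circuit

variable {n d : ℕ}

lemma qA_injective (C : Ens n d) (i : Fin d) : Function.Injective (qA C i) := by
  intro l l' h
  have := congrArg Fin.val ((C.1 i).injective h)
  exact Fin.ext (by simpa using this)

lemma qB_injective (C : Ens n d) (i : Fin d) : Function.Injective (qB C i) := by
  intro l l' h
  have := congrArg Fin.val ((C.1 i).injective h)
  exact Fin.ext (by simpa using this)

lemma qA_ne_qB (C : Ens n d) (i : Fin d) (l l' : Fin (n / 2)) : qA C i l ≠ qB C i l' := by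
  intro h
  have := congrArg Fin.val ((C.1 i).injective h)
  simp only at this
  omega

lemma exists_gate_touching (hn : Even n) (C : Ens n d) (i : Fin d) (j : Fin n) :
    ∃ l, qA C i l = j ∨ qB C i l = j := by
  obtain ⟨t, rfl⟩ := (C.1 i).surjective j
  have hn' : n % 2 = 0 := Nat.even_iff.1 hn
  have ht := t.2
  refine ⟨⟨t.1 / 2, by omega⟩, ?_⟩
  rcases Nat.mod_two_eq_zero_or_one t.1 with h | h
  · left
    exact congrArg (C.1 i) (Fin.ext (by simp only; omega))
  · right
    exact congrArg (C.1 i) (Fin.ext (by simp only; omega))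

lemma interactionAdj_symm (C : Ens n d) (j k : Fin n) (h : interactionAdj C j k) :
    interactionAdj C k j := by
  obtain ⟨hne, i, l, h⟩ := h
  exact ⟨hne.symm, i, l, h.symm⟩

lemma interactionAdj_of_gate (C : Ens n d) (i : Fin d) (l : Fin (n / 2)) :
    interactionAdj C (qA C i l) (qB C i l) :=
  ⟨qA_ne_qB C i l l, i, l, Or.inl ⟨rfl, rfl⟩⟩

lemma exists_interactionAdj (hn : Even n) (hd : 1 ≤ d) (C : Ens n d) (j : Fin n) :
    ∃ k, interactionAdj C j k := by
  obtain ⟨l, rfl | rfl⟩ := exists_gate_touching hn C ⟨0, hd⟩ j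
  · exact ⟨_, interactionAdj_of_gate C _ l⟩
  · exact ⟨_, interactionAdj_symm C _ _ (interactionAdj_of_gate C _ l)⟩

lemma card_interactionAdj_le (C : Ens n d) (j : Fin n) :
    (Finset.univ.filter fun k => interactionAdj C j k).card ≤ d := by
  set N : Fin d → Finset (Fin n) := fun i => Finset.univ.filter fun k =>
    ∃ l, (qA C i l = j ∧ qB C i l = k) ∨ (qA C i l = k ∧ qB C i l = j) with hN
  have hsub : (Finset.univ.filter fun k => interactionAdj C j k) ⊆ Finset.univ.biUnion N := by
    intro k hk
    obtain ⟨-, i, l, h⟩ := (Finset.mem_filter.1 hk).2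
    exact Finset.mem_biUnion.2 ⟨i, Finset.mem_univ _, by simpa [hN] using ⟨l, h⟩⟩
  have hone : ∀ i ∈ Finset.univ, (N i).card ≤ 1 := by
    intro i _
    rw [Finset.card_le_one]
    intro k hk k' hk'
    obtain ⟨l, h⟩ := (Finset.mem_filter.1 hk).2
    obtain ⟨l', h'⟩ := (Finset.mem_filter.1 hk').2
    rcases h with ⟨h1, h2⟩ | ⟨h1, h2⟩ <;> rcases h' with ⟨h1', h2'⟩ | ⟨h1', h2'⟩
    · have := qA_injective C i (h1.trans h1'.symm)
      rw [← h2, ← h2', this]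
    · exact absurd (h1.trans h2'.symm) (qA_ne_qB C i l l')
    · exact absurd (h1'.trans h2.symm) (qA_ne_qB C i l' l)
    · have := qB_injective C i (h2.trans h2'.symm)
      rw [← h1, ← h1', this]
  calc _ ≤ (Finset.univ.biUnion N).card := Finset.card_le_card hsub
    _ ≤ (Finset.univ : Finset (Fin d)).card * 1 := Finset.card_biUnion_le_card_mul _ _ _ hone
    _ = d := by simp

/-- The gates of a circuit in order of multiplication. -/
def gateList (d m : ℕ) : List (Fin d × Fin m) :=
  List.finRange d ×ˢ List.finRange m

lemma gateList_nodup (d m : ℕ) : (gateList d m).Nodup :=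
  (List.nodup_finRange d).product (List.nodup_finRange m)

lemma circU_eq_prod (C : Ens n d)
    (f : Fin d → Fin (n / 2) → Matrix (Fin 2 × Fin 2) (Fin 2 × Fin 2) ℂ) :
    circU C f = ((gateList d (n / 2)).map fun k =>
      applyGate (qA C k.1 k.2) (qB C k.1 k.2) (f k.1 k.2)).prod := by
  unfold circU layerU gateList
  generalize List.finRange d = L
  induction L with
  | nil => simp
  | cons i L ih => simp [List.product_cons, ih, Function.comp_def]

/-- A set of qubits `T` is touched by at most `d * |T|` gates. -/
lemma countP_gateList_le (C : Ens n d) (T : Finset (Fin n)) :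
    ((gateList d (n / 2)).countP fun k => qA C k.1 k.2 ∈ T ∨ qB C k.1 k.2 ∈ T) ≤ d * T.card := by
  have hcount : ((gateList d (n / 2)).countP fun k => qA C k.1 k.2 ∈ T ∨ qB C k.1 k.2 ∈ T) =
      (Finset.univ.filter fun k : Fin d × Fin (n / 2) =>
        qA C k.1 k.2 ∈ T ∨ qB C k.1 k.2 ∈ T).card := by
    rw [List.countP_eq_length_filter, ← List.toFinset_card_of_nodup
      ((gateList_nodup d (n / 2)).filter _)]
    congr 1
    ext ⟨i, l⟩
    simp [gateList]
  rw [hcount]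
  have hmap : d * T.card = ((Finset.univ : Finset (Fin d)) ×ˢ T).card := by
    simp
  rw [hmap]
  refine Finset.card_le_card_of_injOn
    (fun k => (k.1, if qA C k.1 k.2 ∈ T then qA C k.1 k.2 else qB C k.1 k.2)) ?_ ?_
  · intro k hk
    have hk := (Finset.mem_filter.1 hk).2
    simp only [Finset.coe_product, Finset.coe_univ, Set.mem_prod, Set.mem_univ, true_and,
      Finset.mem_coe]
    split_ifs with h
    · exact h
    · exact hk.resolve_left h
  · rintro ⟨i, l⟩ - ⟨i', l'⟩ - h
    simp only [Prod.mk.injEq] at h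
    obtain ⟨rfl, h⟩ := h
    congr 1
    split_ifs at h
    · exact qA_injective C i h
    · exact absurd h (qA_ne_qB C i l l')
    · exact absurd h.symm (qA_ne_qB C i l' l)
    · exact qB_injective C i h

/-- The two qubits of a gate lie in a common block of the greedy partition. -/
def gateKept (C : Ens n d) (k : Fin d × Fin (n / 2)) : Prop :=
  sameBlock n (interactionAdj C) (qA C k.1 k.2) (qB C k.1 k.2)

/-- Gates touching a center of the greedy partition are kept. -/
lemma exists_centers (hn : Even n) (hd : 1 ≤ d) (C : Ens n d) :
    ∃ S : Finset (Fin n), n ≤ S.card * (d ^ 2 + 1) ∧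
      ∀ k, qA C k.1 k.2 ∈ S ∨ qB C k.1 k.2 ∈ S → gateKept C k := by
  obtain ⟨S, -, hS, hcard⟩ := exists_greedy_centers hd (interactionAdj_symm C)
    (card_interactionAdj_le C) (exists_interactionAdj hn hd C) n Finset.univ (by simp)
  refine ⟨S, by simpa using hcard, ?_⟩
  rintro ⟨i, l⟩ (h | h)
  · refine ⟨_, Finset.mem_union_left _ (hS _ h), Finset.mem_insert_self _ _, ?_⟩
    simp [interactionAdj_of_gate C i l]
  · refine ⟨_, Finset.mem_union_left _ (hS _ h), ?_, Finset.mem_insert_self _ _⟩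
    simp [interactionAdj_symm C _ _ (interactionAdj_of_gate C i l)]

lemma xebSpoof_eq_sum (C : Ens n d) :
    xebSpoof n d C = ∑ T : Finset (Fin n),
      circCorr (fun k => qA C k.1 k.2) (fun k => qB C k.1 k.2) (gateKept C)
        (gateList d (n / 2)) (zString T) C.2 := by
  unfold circCorr
  rw [← sum_normSq_mul_normSq, xebSpoof]
  congr 1
  refine Finset.sum_congr rfl fun x _ => ?_
  rw [spoofDist, outDist, circU_eq_prod, circU_eq_prod]
  simp only [runState, Matrix.mulVec_single_one, Matrix.col_apply]
  rfl

/-- The averaged score for fixed qubit permutations. -/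
lemma le_integral_xebSpoof (hn : Even n) (hd : 1 ≤ d) (σ : Fin d → Equiv.Perm (Fin n))
    (μ : Measure (Fin d → Fin (n / 2) → Gate)) [μ.IsMulLeftInvariant] [IsProbabilityMeasure μ] :
    Real.rpow (1 + (1 / 15 : ℝ) ^ d) ((n : ℝ) / ((d : ℝ) ^ 2 + 1)) ≤
      ∫ g, xebSpoof n d (σ, g) ∂μ := by
  set C : Ens n d := (σ, 1) with hC
  set a : Fin d × Fin (n / 2) → Fin n := fun k => qA C k.1 k.2 with ha
  set b : Fin d × Fin (n / 2) → Fin n := fun k => qB C k.1 k.2 with hb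
  have hab : ∀ k, a k ≠ b k := fun k => qA_ne_qB C k.1 k.2 k.2
  have hx : ∀ g, xebSpoof n d (σ, g) = ∑ T : Finset (Fin n),
      circCorr a b (gateKept C) (gateList d (n / 2)) (zString T) g := fun g =>
    xebSpoof_eq_sum (σ, g)
  obtain ⟨S, hcard, hS⟩ := exists_centers hn hd C
  simp only [hx]
  rw [integral_finsetSum _ fun T _ => integrable_circCorr μ _ _ _ _ _]
  have hbase : (1 : ℝ) ≤ 1 + (1 / 15 : ℝ) ^ d := by
    have : (0 : ℝ) ≤ (1 / 15 : ℝ) ^ d := by positivity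
    linarith
  calc Real.rpow (1 + (1 / 15 : ℝ) ^ d) ((n : ℝ) / ((d : ℝ) ^ 2 + 1))
      ≤ (1 + (1 / 15 : ℝ) ^ d) ^ (S.card : ℝ) := by
        refine Real.rpow_le_rpow_of_exponent_le hbase ?_
        rw [div_le_iff₀ (by positivity)]
        exact_mod_cast hcard
    _ = ∑ T ∈ S.powerset, ((1 / 15 : ℝ) ^ d) ^ T.card := by
        rw [Real.rpow_natCast, add_comm, ← Finset.sum_pow_mul_eq_add_pow]
        simp
    _ ≤ ∑ T ∈ S.powerset,
          ∫ g, circCorr a b (gateKept C) (gateList d (n / 2)) (zString T) g ∂μ := by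
        refine Finset.sum_le_sum fun T hT => ?_
        rw [Finset.mem_powerset] at hT
        rw [← pow_mul]
        exact (pow_le_pow_of_le_one (by norm_num) (by norm_num) (countP_gateList_le C T)).trans
          (le_integral_circCorr_zString μ hab (gateList_nodup d (n / 2)) T
            fun k hk => hS k (hk.imp (@hT _) (@hT _)))
    _ ≤ _ := Finset.sum_le_sum_of_subset_of_nonneg (Finset.subset_univ _)
          fun T _ _ => integral_circCorr_nonneg μ hab (gateList_nodup d (n / 2)) _

lemma continuous_xebSpoof (σ : Fin d → Equiv.Perm (Fin n)) :
    Continuous fun g => xebSpoof n d (σ, g) := by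
  simp only [xebSpoof_eq_sum]
  exact continuous_finsetSum _ fun T _ =>
    continuous_circCorr (fun k => qA ((σ, 1) : Ens n d) k.1 k.2)
      (fun k => qB ((σ, 1) : Ens n d) k.1 k.2) (gateKept ((σ, 1) : Ens n d)) _ _

lemma integrable_xebSpoof (μ : Measure (Ens n d)) [IsFiniteMeasure μ] :
    Integrable (xebSpoof n d) μ := by
  have hbound : ∀ σ : Fin d → Equiv.Perm (Fin n), ∃ B : ℝ, ∀ g, ‖xebSpoof n d (σ, g)‖ ≤ B := by
    intro σ
    obtain ⟨B, hB⟩ := isCompact_univ.exists_bound_of_continuousOn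
      (continuous_xebSpoof σ).continuousOn
    exact ⟨B, fun g => hB g (Set.mem_univ g)⟩
  choose B hB using hbound
  obtain ⟨M, hM⟩ := Finite.bddAbove_range B
  refine Integrable.of_bound (C := M) (Measurable.aestronglyMeasurable
    (measurable_from_prod_countable_right fun σ => (continuous_xebSpoof σ).measurable))
    (Filter.Eventually.of_forall fun C => ?_)
  exact (hB C.1 C.2).trans (hM (Set.mem_range_self _))

end Circuit

/-- for every even `n ≥ 2` and `d ≥ 1`, the spoofing algorithm `A` of Gao et
al. with the greedy partition strategy satisfies
`E_{U∼𝒟_{n,d}}[XEB(U,A)] ≥ (1 + (1/15)^d)^{n/(d²+1)}`. -/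
theorem spoof_expected_xeb_lower_bound (n d : ℕ) (hn2 : 2 ≤ n) (hn : Even n) (hd : 1 ≤ d)
    (μG : Measure Gate) [μG.IsHaarMeasure] [IsProbabilityMeasure μG] :
    Real.rpow (1 + (1 / 15 : ℝ) ^ d) ((n : ℝ) / ((d : ℝ) ^ 2 + 1))
      ≤ ∫ C : Ens n d, xebSpoof n d C ∂(ensMeasure n d μG) := by
  have : IsProbabilityMeasure (PMF.uniformOfFintype (Equiv.Perm (Fin n))).toMeasure :=
    PMF.toMeasure.isProbabilityMeasure _
  have : (Measure.pi fun _ : Fin d => Measure.pi fun _ : Fin (n / 2) => μG).IsMulLeftInvariant :=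
    Measure.pi.isMulLeftInvariant _
  unfold ensMeasure
  rw [integral_prod _ (integrable_xebSpoof _)]
  calc Real.rpow (1 + (1 / 15 : ℝ) ^ d) ((n : ℝ) / ((d : ℝ) ^ 2 + 1))
      = ∫ _ : Fin d → Equiv.Perm (Fin n),
          Real.rpow (1 + (1 / 15 : ℝ) ^ d) ((n : ℝ) / ((d : ℝ) ^ 2 + 1))
          ∂(Measure.pi fun _ : Fin d =>
            (PMF.uniformOfFintype (Equiv.Perm (Fin n))).toMeasure) := by simp
    _ ≤ _ := integral_mono (integrable_const _) (integrable_xebSpoof _).integral_prod_left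
        fun σ => le_integral_xebSpoof hn hd σ _

end
end

section
/- Let n ≥ 1, let U be an n-qubit unitary (a 2^n × 2^n unitary matrix acting on (ℂ²)^{⊗n}), and let x ∈ {0,1}^n with Hamming weight |x|. Define iY = ⊗_{i=1}^n (i·σ^y) and the time-reversed unitary U^𝒯 = (iY)† U* (iY), where U* is the entrywise complex conjugate. Then |⟨x|U|0^n⟩|² = (−1)^{|x|} · ⟨x, x̄ | U ⊗ U^𝒯 | 0^n, 1^n⟩, where x̄ denotes the bitwise complement of x, |x, x̄⟩ = |x⟩⊗|x̄⟩ ∈ (ℂ²)^{⊗n} ⊗ (ℂ²)^{⊗n}, and |0^n, 1^n⟩ = |0^n⟩⊗|1^n⟩. -/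
open scoped Kronecker BigOperators

/-- The Pauli matrix `σ^y`. -/
noncomputable def pauliY : Matrix (Fin 2) (Fin 2) ℂ := !![0, -Complex.I; Complex.I, 0]

/-- The `n`-fold tensor power `M^{⊗n}` of a single-qubit operator, as a matrix on
`(ℂ²)^{⊗n}` (indexed by bitstrings `Fin n → Fin 2`). -/
noncomputable def tensorPow (n : ℕ) (M : Matrix (Fin 2) (Fin 2) ℂ) :
    Matrix (Fin n → Fin 2) (Fin n → Fin 2) ℂ :=
  Matrix.of fun x y => ∏ i, M (x i) (y i)

/-- `iY = ⊗_{i=1}^n (i·σ^y)`. -/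
noncomputable def iY (n : ℕ) : Matrix (Fin n → Fin 2) (Fin n → Fin 2) ℂ :=
  tensorPow n (Complex.I • pauliY)

/-- The time-reversed unitary `U^𝒯 = (iY)† U* (iY)`, where `U*` is the entrywise complex
conjugate. -/
noncomputable def timeReversal {n : ℕ} (U : Matrix (Fin n → Fin 2) (Fin n → Fin 2) ℂ) :
    Matrix (Fin n → Fin 2) (Fin n → Fin 2) ℂ :=
  (iY n).conjTranspose * U.map (starRingEnd ℂ) * iY n

/-- Hamming weight of a bitstring. -/
def hamming {n : ℕ} (x : Fin n → Fin 2) : ℕ := (Finset.univ.filter fun i => x i = 1).card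

/-- Bitwise complement of a bitstring. -/
def bitFlip {n : ℕ} (x : Fin n → Fin 2) : Fin n → Fin 2 := fun i => if x i = 0 then 1 else 0

theorem iY_apply_bitFlip {n : ℕ} (x z : Fin n → Fin 2) :
    iY n x (bitFlip z) = if x = z then (-1 : ℂ) ^ hamming z else 0 := by
  have factor : ∀ a b : Fin 2, (Complex.I • pauliY) a (if b = 0 then 1 else 0) =
      if a = b then (if b = 1 then (-1 : ℂ) else 1) else 0 := by
    intro a b
    fin_cases a <;> fin_cases b <;> simp [pauliY]
  simp only [iY, tensorPow, bitFlip, Matrix.of_apply, factor]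
  split_ifs with h
  · subst h
    simp [hamming, Finset.prod_ite]
  · obtain ⟨i, hi⟩ := Function.ne_iff.mp h
    exact Finset.prod_eq_zero (Finset.mem_univ i) (if_neg hi)

theorem timeReversal_apply_bitFlip {n : ℕ} (U : Matrix (Fin n → Fin 2) (Fin n → Fin 2) ℂ)
    (x y : Fin n → Fin 2) :
    timeReversal U (bitFlip x) (bitFlip y) =
      (-1 : ℂ) ^ hamming x * starRingEnd ℂ (U x y) * (-1 : ℂ) ^ hamming y := by
  simp [timeReversal, Matrix.mul_apply, iY_apply_bitFlip, apply_ite (starRingEnd ℂ)]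

/-- for an `n`-qubit unitary `U` and a bitstring `x`,
`|⟨x|U|0^n⟩|² = (−1)^{|x|} ⟨x,x̄| U ⊗ U^𝒯 |0^n,1^n⟩`, where `U^𝒯 = (iY)† U* (iY)` and `x̄`
is the bitwise complement of `x`. -/
theorem transition_prob_doubled {n : ℕ} (hn : 1 ≤ n)
    (U : Matrix (Fin n → Fin 2) (Fin n → Fin 2) ℂ)
    (hU : U ∈ Matrix.unitaryGroup (Fin n → Fin 2) ℂ) (x : Fin n → Fin 2) :
    (Complex.normSq (U x (fun _ => 0)) : ℂ) =
      (-1 : ℂ) ^ hamming x *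
        (U ⊗ₖ timeReversal U) (x, bitFlip x) ((fun _ => 0), (fun _ => 1)) := by
  have flip_zero : (fun _ => 1 : Fin n → Fin 2) = bitFlip (fun _ => 0) := by
    funext i
    simp [bitFlip]
  have hamming_zero : hamming (fun _ => 0 : Fin n → Fin 2) = 0 := by
    simp [hamming]
  have sign_sq : (-1 : ℂ) ^ hamming x * (-1 : ℂ) ^ hamming x = 1 := by
    rw [← mul_pow]
    simp
  rw [Matrix.kronecker_apply, flip_zero, timeReversal_apply_bitFlip, hamming_zero,
    Complex.normSq_eq_conj_mul_self]
  linear_combination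
    -(U x (fun _ => 0) * starRingEnd ℂ (U x (fun _ => 0))) * sign_sq
end
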